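/- For every K ∈ ℕ and every constant c > 1/2 there exists D₀ such that the following holds. Let G ∈ H(K) be a finite graph with δ(G) ≥ D₀, let x ∈ V(G), let p := 1/2 − c·√(log d(x)/d(x)), let A₀ be a p-random subset of V(G), and let (Â_ℓ) be the Boot₂(γ) process started from A₀. Then Pr[x ∈ Â₂ \ Â₁] ≤ exp(−√(d(x))). -/

import Mathlib

open SimpleGraph Filter

namespace MBP

/-- Degree of a vertex, via the cardinality of its neighbourhood. -/
noncomputable def deg {V : Type} (G : SimpleGraph V) (x : V) : ℕ :=
  (G.neighborSet x).ncard

/-- Minimum degree. -/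
noncomputable def minDeg {V : Type} (G : SimpleGraph V) : ℕ :=
  sInf (Set.range (deg G))

/-- Maximum degree. -/
noncomputable def maxDeg {V : Type} (G : SimpleGraph V) : ℕ :=
  sSup (Set.range (deg G))

/-- Ball of radius `ℓ` around `x`. -/
def ball {V : Type} (G : SimpleGraph V) (x : V) (ℓ : ℕ) : Set V :=
  {y | G.edist x y ≤ ℓ}

/-- Sphere of radius `ℓ` around `x` (for `ℓ ≥ 1` this is `B(x,ℓ) \ B(x,ℓ-1)`). -/
def sphere {V : Type} (G : SimpleGraph V) (x : V) (ℓ : ℕ) : Set V :=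
  {y | G.edist x y = ℓ}

/-- (P1) locally K-almost regular. -/
def P1 (K : ℕ) {V : Type} (G : SimpleGraph V) : Prop :=
  ∀ (x : V) (ℓ : ℕ), 1 ≤ ℓ → ∀ y ∈ sphere G x ℓ,
    |(deg G x : ℤ) - (deg G y : ℤ)| ≤ (K : ℤ) * ℓ

/-- (P2) K-bounded backwards expansion. -/
def P2 (K : ℕ) {V : Type} (G : SimpleGraph V) : Prop :=
  ∀ (x : V) (ℓ : ℕ), 1 ≤ ℓ → ∀ y ∈ sphere G x ℓ,
    (G.neighborSet y ∩ ball G x ℓ).ncard ≤ K * ℓ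

/-- `D` witnesses property (P3) (typical local structure and K-separation) at vertex `x`. -/
def P3At (K : ℕ) {V : Type} (G : SimpleGraph V) (x : V) (D : Set V) : Prop :=
  x ∉ D ∧ ∀ (ℓ : ℕ), 1 ≤ ℓ →
    ((D ∩ sphere G x ℓ).ncard ≤ K ^ (ℓ - 1) * (deg G x) ^ (ℓ - 1)) ∧
    (∀ y ∈ sphere G x ℓ \ D, (D ∩ G.neighborSet y).ncard ≤ K * ℓ) ∧
    (∀ y ∈ sphere G x ℓ \ D, ∀ z ∈ sphere G x ℓ \ D, y ≠ z →
      (G.neighborSet y ∩ G.neighborSet z ∩ (sphere G x (ℓ + 1) \ D)).ncard ≤ 1) ∧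
    (∀ y ∈ sphere G x ℓ \ D,
      (ball G y (2 * ℓ - 1) ∩ (sphere G x ℓ \ D)).ncard ≤ ℓ * K ^ (ℓ - 1) * (deg G x) ^ (ℓ - 1))

/-- (P3) typical local structure and K-separation. -/
def P3 (K : ℕ) {V : Type} (G : SimpleGraph V) : Prop :=
  ∀ x : V, ∃ D : Set V, P3At K G x D

/-- (P5) exponential order. -/
def P5 (K : ℕ) {V : Type} (G : SimpleGraph V) : Prop :=
  (Nat.card V : ℝ) ≤ Real.exp (K * minDeg G)

/-- (P4) K-projection, relative to a membership predicate `mem` for the projected subgraphs. -/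
def P4With (K : ℕ) {V : Type} (G : SimpleGraph V) (mem : G.Subgraph → Prop) : Prop :=
  ∀ (x : V) (ℓ : ℕ), 1 ≤ ℓ → ∀ y ∈ sphere G x ℓ,
    ∃ H : G.Subgraph, y ∈ H.verts ∧ mem H ∧
      H.verts ∩ ball G x (ℓ - 1) = ∅ ∧
      ∀ w : H.verts, |(deg H.coe w : ℤ) - (deg G (w : V) : ℤ)| ≤ (K : ℤ) * ℓ

/-- Membership in the class H(K) with recursion fuel `n`. -/
def HAux (K : ℕ) : ℕ → (V : Type) → SimpleGraph V → Prop
  | 0, V, _ => Nat.card V = 1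
  | n + 1, V, G =>
      Nat.card V = 1 ∨
        (P1 K G ∧ P2 K G ∧ P3 K G ∧ P4With K G (fun H => HAux K n H.verts H.coe) ∧ P5 K G)

/-- The class `H(K)` of geometric graphs: least class containing the one-vertex graph and
closed under properties (P1)–(P5), where the projections of (P4) again lie in the class. -/
def InH (K : ℕ) {V : Type} (G : SimpleGraph V) : Prop :=
  ∃ n, HAux K n V G

/-- One round of majority bootstrap percolation: a vertex `v` becomes infected if at least
`d(v)/2` of its neighbours are infected. -/
def bootStep {V : Type} (G : SimpleGraph V) (A : Set V) : Set V :=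
  A ∪ {v | (deg G v : ℝ) / 2 ≤ ((G.neighborSet v ∩ A).ncard : ℝ)}

/-- The majority bootstrap percolation process. -/
def bootIter {V : Type} (G : SimpleGraph V) (A0 : Set V) : ℕ → Set V
  | 0 => A0
  | n + 1 => bootStep G (bootIter G A0 n)

/-- `A0` percolates if eventually every vertex is infected. -/
def Percolates {V : Type} (G : SimpleGraph V) (A0 : Set V) : Prop :=
  (⋃ i, bootIter G A0 i) = Set.univ

/-- Weight of a subset `A` under the `p`-random measure. -/
noncomputable def weight {V : Type} (p : ℝ) (A : Set V) : ℝ :=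
  p ^ A.ncard * (1 - p) ^ (Aᶜ).ncard

/-- Probability that a `p`-random subset of `V` satisfies the event `E`. -/
noncomputable def prob {V : Type} (p : ℝ) (E : Set V → Prop) : ℝ :=
  ∑ᶠ A ∈ {A : Set V | E A}, weight p A

/-- Probability that a `p`-random initial set percolates. -/
noncomputable def Phi {V : Type} (p : ℝ) (G : SimpleGraph V) : ℝ :=
  prob p (fun A0 => Percolates G A0)

/-- One round of the `m`-shifted bootstrap process (threshold `d(v)/2 + m`). -/
def bootStepM {V : Type} (G : SimpleGraph V) (m : ℕ) (A : Set V) : Set V :=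
  A ∪ {v | (deg G v : ℝ) / 2 + m ≤ ((G.neighborSet v ∩ A).ncard : ℝ)}

/-- The `m`-shifted bootstrap process. -/
def bootIterM {V : Type} (G : SimpleGraph V) (m : ℕ) (A0 : Set V) : ℕ → Set V
  | 0 => A0
  | n + 1 => bootStepM G m (bootIterM G m A0 n)

/-- `σ(x) = √(log d(x) / d(x))`. -/
noncomputable def sigma' {V : Type} (G : SimpleGraph V) (x : V) : ℝ :=
  Real.sqrt (Real.log (deg G x) / (deg G x))

/-- `γ(x) = √(d(x) / √(log d(x)))`. -/
noncomputable def gamma' {V : Type} (G : SimpleGraph V) (x : V) : ℝ :=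
  Real.sqrt ((deg G x : ℝ) / Real.sqrt (Real.log (deg G x)))

/-- The `Boot₂(γ)` process: in the step from round `ℓ` to round `ℓ+1`, a vertex `v` becomes
infected if at least `d(v)/2 - max(0, 2-ℓ)·γ(v)` of its neighbours are infected. -/
noncomputable def hatIter {V : Type} (G : SimpleGraph V) (A0 : Set V) : ℕ → Set V
  | 0 => A0
  | ℓ + 1 =>
      hatIter G A0 ℓ ∪
        {v | (deg G v : ℝ) / 2 - ((2 - ℓ : ℕ) : ℝ) * gamma' G v
              ≤ ((G.neighborSet v ∩ hatIter G A0 ℓ).ncard : ℝ)}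

/-- Expectation of `f` restricted to the event `E`, under the `p`-random measure. -/
noncomputable def expOn {V : Type} (p : ℝ) (E : Set V → Prop) (f : Set V → ℝ) : ℝ :=
  ∑ᶠ A ∈ {A : Set V | E A}, weight p A * f A

/-- Conditional expectation of `f` given the event `E`. -/
noncomputable def condExp {V : Type} (p : ℝ) (E : Set V → Prop) (f : Set V → ℝ) : ℝ :=
  expOn p E f / prob p E

/-- Conditional variance of `f` given the event `E`. -/
noncomputable def condVar {V : Type} (p : ℝ) (E : Set V → Prop) (f : Set V → ℝ) : ℝ :=
  condExp p E (fun A => (f A - condExp p E f) ^ 2)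

/-- The number of edges between `U` and `W` (ordered pairs `(u,w)` with `u ∈ U`, `w ∈ W`
adjacent; for disjoint sets this is the number of edges with one endpoint in each). -/
noncomputable def eBetween {V : Type} (G : SimpleGraph V) (U W : Set V) : ℕ :=
  {e : V × V | e.1 ∈ U ∧ e.2 ∈ W ∧ G.Adj e.1 e.2}.ncard

/-- Upper tail `Pr[Bin(d,p) ≥ t]` of the binomial distribution. -/
noncomputable def binTail (d : ℕ) (p : ℝ) (t : ℝ) : ℝ :=
  ∑ k ∈ Finset.range (d + 1),
    if t ≤ (k : ℝ) then (d.choose k : ℝ) * p ^ k * (1 - p) ^ (d - k) else 0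


/-- Hoeffding's lemma for a Bernoulli variable. -/
lemma bern_mgf (p s : ℝ) (h0 : 0 ≤ p) (h1 : p ≤ 1) :
    p * Real.exp s + (1 - p) ≤ Real.exp (p * s + s ^ 2 / 8) := by
  let X : Bool → ℝ := fun b => if b then 1 else 0
  let P : MeasureTheory.Measure Bool := ProbabilityTheory.bernoulliMeasure true false ⟨p, h0, h1⟩
  have hm : AEMeasurable X P := (measurable_of_finite X).aemeasurable
  have hb : ∀ᵐ b ∂P, X b ∈ Set.Icc (0 : ℝ) 1 := by
    refine Filter.Eventually.of_forall (fun b => ?_)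
    cases b <;> simp [X]
  have h := ProbabilityTheory.hasSubgaussianMGF_of_mem_Icc hm hb
  have h2 := h.mgf_le s
  have hE : ∫ b, X b ∂P = p := by
    simp only [P]
    rw [ProbabilityTheory.integral_bernoulliMeasure]
    simp [X]
  rw [hE] at h2
  have hmgf : ProbabilityTheory.mgf (fun b => X b - p) P s
      = p * Real.exp (s * (1 - p)) + (1 - p) * Real.exp (s * (0 - p)) := by
    unfold ProbabilityTheory.mgf
    simp only [P]
    rw [ProbabilityTheory.integral_bernoulliMeasure]
    simp [X]
  rw [hmgf] at h2
  have h3 : p * Real.exp s + (1 - p)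
      = Real.exp (p * s) * (p * Real.exp (s * (1 - p)) + (1 - p) * Real.exp (s * (0 - p))) := by
    have e1 : Real.exp (p * s) * Real.exp (s * (1 - p)) = Real.exp s := by
      rw [← Real.exp_add]; congr 1; ring
    have e2 : Real.exp (p * s) * Real.exp (s * (0 - p)) = 1 := by
      rw [← Real.exp_add, ← Real.exp_zero]; congr 1; ring
    linear_combination (-p) * e1 - (1 - p) * e2
  rw [h3, Real.exp_add]
  refine mul_le_mul_of_nonneg_left (h2.trans (le_of_eq ?_)) (Real.exp_pos _).le
  congr 1
  simp
  ring

lemma mgf_sum {V : Type} [Fintype V] [DecidableEq V] (p : ℝ) (f : V → ℝ) :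
    ∑ A : Finset V, weight p (A : Set V) * Real.exp (∑ z ∈ A, f z)
      = ∏ z, (p * Real.exp (f z) + (1 - p)) := by
  rw [Finset.prod_add, Finset.powerset_univ]
  refine Finset.sum_congr rfl (fun A _ => ?_)
  unfold weight
  rw [Real.exp_sum, Finset.prod_mul_distrib, Finset.prod_const, Finset.prod_const,
    Set.ncard_coe_finset, ← Finset.coe_compl, Set.ncard_coe_finset, Finset.compl_eq_univ_sdiff]
  ring

lemma weight_nonneg {V : Type} (p : ℝ) (h0 : 0 ≤ p) (h1 : p ≤ 1) (A : Set V) :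
    0 ≤ weight p A := by
  unfold weight
  have : 0 ≤ 1 - p := by linarith
  positivity

open Classical in
lemma prob_eq {V : Type} [Fintype V] (p : ℝ) (E : Set V → Prop) :
    prob p E = ∑ A : Finset V, if E (A : Set V) then weight p (A : Set V) else 0 := by
  unfold prob
  rw [finsum_mem_eq_finite_toFinset_sum _ (Set.toFinite _)]
  have : (Set.toFinite {A : Set V | E A}).toFinset = Finset.univ.filter E := by
    ext; simp
  rw [this, Finset.sum_filter]
  exact (Equiv.sum_comp (Fintype.finsetEquivSet (α := V)) (fun A => if E A then weight p A else 0)).symm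

open Classical in
/-- Union bound combined with an exponential moment bound for weighted sums. -/
lemma prob_le_union {V ι : Type} [Fintype V] (p : ℝ) (h0 : 0 ≤ p) (h1 : p ≤ 1)
    (E : Set V → Prop) (𝒯 : Finset ι) (m : ι → V → ℝ) (θ : ι → ℝ) (lam B : ℝ) (hl : 0 ≤ lam)
    (hE : ∀ A : Finset V, E (A : Set V) → ∃ T ∈ 𝒯, θ T ≤ ∑ z ∈ A, m T z)
    (hB : ∀ T ∈ 𝒯, -lam * θ T + p * lam * ∑ z, m T z + lam ^ 2 / 8 * ∑ z, m T z ^ 2 ≤ B) :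
    prob p E ≤ (𝒯.card : ℝ) * Real.exp B := by
  rw [prob_eq]
  have key : ∀ A : Finset V, (if E (A : Set V) then weight p (A : Set V) else 0)
      ≤ ∑ T ∈ 𝒯, Real.exp (-lam * θ T) *
          (weight p (A : Set V) * Real.exp (∑ z ∈ A, lam * m T z)) := by
    intro A
    have hw := weight_nonneg p h0 h1 (A : Set V)
    have hnn : ∀ T ∈ 𝒯, 0 ≤ Real.exp (-lam * θ T) *
          (weight p (A : Set V) * Real.exp (∑ z ∈ A, lam * m T z)) := fun T _ => by positivity
    split_ifs with h
    · obtain ⟨T, hT, hθ⟩ := hE A h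
      refine le_trans ?_ (Finset.single_le_sum hnn hT)
      have : 1 ≤ Real.exp (-lam * θ T) * Real.exp (∑ z ∈ A, lam * m T z) := by
        rw [← Real.exp_add, ← Finset.mul_sum]
        apply Real.one_le_exp
        nlinarith
      nlinarith
    · exact Finset.sum_nonneg hnn
  refine (Finset.sum_le_sum (fun A _ => key A)).trans ?_
  rw [Finset.sum_comm, ← nsmul_eq_mul]
  refine Finset.sum_le_card_nsmul _ _ _ (fun T hT => ?_)
  rw [← Finset.mul_sum, mgf_sum]
  have : ∏ z, (p * Real.exp (lam * m T z) + (1 - p))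
      ≤ ∏ z, Real.exp (p * (lam * m T z) + (lam * m T z) ^ 2 / 8) := by
    refine Finset.prod_le_prod (fun z _ => ?_) (fun z _ => bern_mgf _ _ h0 h1)
    have : 0 ≤ 1 - p := by linarith
    positivity
  refine (mul_le_mul_of_nonneg_left this (Real.exp_pos _).le).trans ?_
  rw [← Real.exp_sum, ← Real.exp_add]
  apply Real.exp_le_exp.2
  refine le_trans (le_of_eq ?_) (hB T hT)
  rw [Finset.sum_add_distrib, Finset.mul_sum, Finset.mul_sum, ← add_assoc]
  congr 1
  · congr 1
    exact Finset.sum_congr rfl (fun _ _ => by ring)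
  · exact Finset.sum_congr rfl (fun _ _ => by ring)

/-- The asymptotic inequalities needed. -/
lemma analytic (K : ℕ) (c c₁ η : ℝ) (hc : c₁ < c) (hη : 0 < η) :
    ∃ D₀ : ℕ, 3 ≤ D₀ ∧ ∀ d : ℕ, D₀ ≤ d →
      c * √(Real.log d) ≤ √d / 2 ∧ (K : ℝ) ≤ √d ∧ 4 ≤ (c - c₁) * √(Real.log d) ∧
      1 ≤ √(Real.log d) ∧
      K + 2 * K * (√d + 1) ≤ η * d ∧
      1 + Real.log (√(Real.log d)) / 2 ≤ η * Real.log d ∧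
      1 ≤ η * √√(Real.log d) ^ 3 := by
  have hd : Tendsto (fun d : ℕ => (d : ℝ)) atTop atTop := tendsto_natCast_atTop_atTop
  have hs : Tendsto (fun x : ℝ => √x) atTop atTop := Real.tendsto_sqrt_atTop
  have hr : Tendsto (fun d : ℕ => √(d : ℝ)) atTop atTop := hs.comp hd
  have hL : Tendsto (fun d : ℕ => Real.log (d : ℝ)) atTop atTop := Real.tendsto_log_atTop.comp hd
  have hl : Tendsto (fun d : ℕ => √(Real.log (d : ℝ))) atTop atTop := hs.comp hL
  have hq : Tendsto (fun d : ℕ => √√(Real.log (d : ℝ))) atTop atTop := hs.comp hl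
  have e1 : ∀ᶠ d : ℕ in atTop, c * √(Real.log d) ≤ √d / 2 := by
    have h := (Real.isLittleO_log_id_atTop.bound
      (show (0 : ℝ) < 1 / (4 * (c ^ 2 + 1)) by positivity))
    filter_upwards [hd.eventually h, hL.eventually_ge_atTop 0] with d h1 h2
    simp only [id, Real.norm_eq_abs, abs_of_nonneg h2, Nat.abs_cast] at h1
    have : c ^ 2 * Real.log d ≤ d / 4 := by
      rw [div_mul_eq_mul_div, one_mul, le_div_iff₀ (by positivity)] at h1
      nlinarith
    apply le_of_sq_le_sq _ (by positivity)
    rw [mul_pow, div_pow, Real.sq_sqrt h2, Real.sq_sqrt (by positivity)]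
    linarith
  have e2 := hr.eventually_ge_atTop (K : ℝ)
  have e3 : ∀ᶠ d : ℕ in atTop, 4 ≤ (c - c₁) * √(Real.log d) :=
    (hl.const_mul_atTop (sub_pos.2 hc)).eventually_ge_atTop 4
  have e4 := hl.eventually_ge_atTop 1
  have e5 : ∀ᶠ d : ℕ in atTop, K + 2 * K * (√d + 1) ≤ η * d := by
    filter_upwards [(hr.const_mul_atTop hη).eventually_ge_atTop (5 * K),
      hr.eventually_ge_atTop 1] with d h1 h2
    have h3 : √(d : ℝ) * √d = d := Real.mul_self_sqrt (by positivity)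
    have hK : (0 : ℝ) ≤ K := by positivity
    have : 5 * K * √d ≤ η * √d * √d := mul_le_mul_of_nonneg_right h1 (by positivity)
    nlinarith [mul_le_mul_of_nonneg_left h2 hK]
  have e6 : ∀ᶠ d : ℕ in atTop, 1 + Real.log (√(Real.log d)) / 2 ≤ η * Real.log d := by
    filter_upwards [hl.eventually_ge_atTop 1, hL.eventually_ge_atTop 0,
      (hl.const_mul_atTop hη).eventually_ge_atTop 2] with d h1 h2 h3
    have h4 := Real.log_le_sub_one_of_pos (show 0 < √(Real.log (d : ℝ)) by linarith)
    have h5 : √(Real.log (d : ℝ)) * √(Real.log (d : ℝ)) = Real.log d := Real.mul_self_sqrt h2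
    nlinarith [mul_le_mul_of_nonneg_right h3 (show 0 ≤ √(Real.log (d : ℝ)) by linarith)]
  have e7 : ∀ᶠ d : ℕ in atTop, 1 ≤ η * √√(Real.log d) ^ 3 :=
    (((tendsto_pow_atTop (by norm_num : (3 : ℕ) ≠ 0)).comp hq).const_mul_atTop
      hη).eventually_ge_atTop 1
  obtain ⟨D, hD⟩ := eventually_atTop.1 (e1.and (e2.and (e3.and (e4.and (e5.and (e6.and e7))))))
  exact ⟨max 3 D, le_max_left _ _, fun d h => hD d ((le_max_right _ _).trans h)⟩

lemma choose_bound (d t : ℕ) (g : ℝ) (hg : 0 < g) (ht : g ≤ t) :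
    (d.choose t : ℝ) ≤ (Real.exp 1 * d / g) ^ t := by
  have h1 : (d.choose t : ℝ) ≤ (d : ℝ) ^ t / t.factorial := Nat.choose_le_pow_div t d
  have ht0 : (0 : ℝ) < t := hg.trans_le ht
  have h2 : (t : ℝ) ^ t / t.factorial ≤ Real.exp t :=
    Real.pow_div_factorial_le_exp (t : ℝ) ht0.le t
  have h3 : (g : ℝ) ^ t ≤ (t : ℝ) ^ t := by gcongr
  have hf : (0 : ℝ) < t.factorial := by positivity
  have h4 : g ^ t / t.factorial ≤ Real.exp t := le_trans (by gcongr) h2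
  refine h1.trans ?_
  rw [div_pow, mul_pow, ← Real.exp_nat_mul, mul_one, div_le_div_iff₀ hf (by positivity)]
  rw [div_le_iff₀ hf] at h4
  calc (d : ℝ) ^ t * g ^ t ≤ (d : ℝ) ^ t * (Real.exp t * t.factorial) := by gcongr
    _ = _ := by ring

lemma common_le {V : Type} [Finite V] (K : ℕ) (G : SimpleGraph V) (h2 : P2 K G) {x y z : V}
    (hy : G.Adj x y) (hz : G.Adj x z) (hne : y ≠ z) :
    (G.neighborSet y ∩ G.neighborSet z).ncard ≤ 2 * K := by
  have hsub : ∀ ℓ : ℕ, 1 ≤ ℓ → G.neighborSet y ∩ G.neighborSet z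
      ⊆ G.neighborSet z ∩ ball G y ℓ := by
    rintro ℓ hℓ w ⟨hw1, hw2⟩
    refine ⟨hw2, ?_⟩
    have : G.edist y w = 1 := SimpleGraph.edist_eq_one_iff_adj.2 hw1
    show G.edist y w ≤ ℓ
    rw [this]
    exact_mod_cast hℓ
  have key : ∀ ℓ : ℕ, 1 ≤ ℓ → ℓ ≤ 2 → G.edist y z = ℓ →
      (G.neighborSet y ∩ G.neighborSet z).ncard ≤ 2 * K := by
    intro ℓ h1 h2' he
    refine (Set.ncard_le_ncard (hsub ℓ h1) (Set.toFinite _)).trans ?_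
    refine (h2 y ℓ h1 z he).trans ?_
    rw [mul_comm]; exact Nat.mul_le_mul_right _ h2'
  by_cases ha : G.Adj y z
  · exact key 1 le_rfl (by norm_num) (by
      rw [SimpleGraph.edist_eq_one_iff_adj.2 ha]; rfl)
  · refine key 2 (by norm_num) le_rfl ?_
    have := (SimpleGraph.edist_eq_two_iff (G := G) (u := y) (v := z)).2 ⟨hne, ha, x, hy.symm, hz.symm⟩
    rw [this]; rfl

open Classical in
/-- Number of neighbours of `z` in `T`. -/
noncomputable def mult {V : Type} (G : SimpleGraph V) (T : Finset V) (z : V) : ℝ :=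
  ((T.filter (fun y => G.Adj y z)).card : ℝ)

open Classical in
lemma mult_eq {V : Type} (G : SimpleGraph V) (T : Finset V) (z : V) :
    mult G T z = ∑ y ∈ T, if G.Adj y z then (1 : ℝ) else 0 := by
  unfold mult
  simp

open Classical in
lemma sum_mult {V : Type} [Fintype V] (G : SimpleGraph V) (T A : Finset V) :
    ∑ z ∈ A, mult G T z = ∑ y ∈ T, ((G.neighborSet y ∩ (A : Set V)).ncard : ℝ) := by
  simp only [mult_eq]
  rw [Finset.sum_comm]
  refine Finset.sum_congr rfl (fun y _ => ?_)
  have : G.neighborSet y ∩ (A : Set V) = ((A.filter (fun z => G.Adj y z) : Finset V) : Set V) := by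
    ext z; simp [and_comm]
  rw [this, Set.ncard_coe_finset]
  simp

open Classical in
lemma sum_mult_univ {V : Type} [Fintype V] (G : SimpleGraph V) (T : Finset V) :
    ∑ z, mult G T z = ∑ y ∈ T, (deg G y : ℝ) := by
  rw [sum_mult]
  simp [deg]

open Classical in
lemma sum_mult_sq {V : Type} [Fintype V] (K : ℕ) (G : SimpleGraph V) (h2 : P2 K G) (x : V)
    (T : Finset V) (hT : ∀ y ∈ T, G.Adj x y) :
    ∑ z, mult G T z ^ 2 ≤ ∑ y ∈ T, ((deg G y : ℝ) + 2 * K * T.card) := by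
  have h : ∑ z, mult G T z ^ 2
      = ∑ y ∈ T, ∑ w ∈ T, ((G.neighborSet y ∩ G.neighborSet w).ncard : ℝ) := by
    simp only [mult_eq, sq, Finset.sum_mul_sum]
    rw [Finset.sum_comm]
    refine Finset.sum_congr rfl (fun y _ => ?_)
    rw [Finset.sum_comm]
    refine Finset.sum_congr rfl (fun w _ => ?_)
    have : G.neighborSet y ∩ G.neighborSet w
        = ((Finset.univ.filter (fun z => G.Adj y z ∧ G.Adj w z) : Finset V) : Set V) := by
      ext z; simp
    rw [this, Set.ncard_coe_finset, Finset.card_filter]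
    push_cast
    refine Finset.sum_congr rfl (fun z _ => ?_)
    by_cases a : G.Adj y z <;> by_cases b : G.Adj w z <;> simp [a, b]
  rw [h]
  refine Finset.sum_le_sum (fun y hy => ?_)
  rw [← Finset.add_sum_erase _ _ hy, Set.inter_self]
  refine add_le_add le_rfl ?_
  have : ∀ w ∈ T.erase y, ((G.neighborSet y ∩ G.neighborSet w).ncard : ℝ) ≤ 2 * K := by
    intro w hw
    rw [Finset.mem_erase] at hw
    exact_mod_cast common_le K G h2 (hT y hy) (hT w hw.2) hw.1.symm
  refine (Finset.sum_le_card_nsmul _ _ _ this).trans ?_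
  rw [nsmul_eq_mul, mul_comm]
  have h3 : ((T.erase y).card : ℝ) ≤ T.card := by exact_mod_cast Finset.card_erase_le
  gcongr

lemma event_sub {V : Type} [Fintype V] (G : SimpleGraph V) (x : V) (A : Set V)
    (h : x ∈ hatIter G A 2 \ hatIter G A 1) :
    ∃ T : Finset V, T.card = ⌈gamma' G x⌉₊ ∧ (∀ y ∈ T, G.Adj x y) ∧
      ∀ y ∈ T, (deg G y : ℝ) / 2 - 2 * gamma' G y ≤ ((G.neighborSet y ∩ A).ncard : ℝ) := by
  classical
  obtain ⟨h2, h1⟩ := h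
  have h2' : (deg G x : ℝ) / 2 - gamma' G x ≤ ((G.neighborSet x ∩ hatIter G A 1).ncard : ℝ) := by
    rw [hatIter] at h2
    rcases h2 with h2 | h2
    · exact absurd h2 h1
    · simpa using h2
  have hA1 : hatIter G A 1 = A ∪ {v | (deg G v : ℝ) / 2 - 2 * gamma' G v
              ≤ ((G.neighborSet v ∩ A).ncard : ℝ)} := by
    simp [hatIter]
  have h1' : ((G.neighborSet x ∩ A).ncard : ℝ) < (deg G x : ℝ) / 2 - 2 * gamma' G x := by
    rw [hA1] at h1
    by_contra hcon
    exact h1 (Or.inr (not_lt.1 hcon))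
  have hle : (G.neighborSet x ∩ hatIter G A 1).ncard
      ≤ (G.neighborSet x ∩ A).ncard + (G.neighborSet x ∩ (hatIter G A 1 \ A)).ncard := by
    refine le_trans (Set.ncard_le_ncard ?_ (Set.toFinite _)) (Set.ncard_union_le _ _)
    intro y hy
    by_cases hyA : y ∈ A
    · exact Or.inl ⟨hy.1, hyA⟩
    · exact Or.inr ⟨hy.1, hy.2, hyA⟩
  have hle' : ((G.neighborSet x ∩ hatIter G A 1).ncard : ℝ)
      ≤ (G.neighborSet x ∩ A).ncard + (G.neighborSet x ∩ (hatIter G A 1 \ A)).ncard := by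
    exact_mod_cast hle
  have hcard : ⌈gamma' G x⌉₊ ≤ (G.neighborSet x ∩ (hatIter G A 1 \ A)).ncard := by
    rw [Nat.ceil_le]
    linarith
  rw [Set.ncard_eq_toFinset_card' ] at hcard
  obtain ⟨T, hT, hTc⟩ := Finset.exists_subset_card_eq hcard
  have hmem : ∀ y ∈ T, y ∈ G.neighborSet x ∩ (hatIter G A 1 \ A) := fun y hy => by
    simpa using hT hy
  refine ⟨T, hTc, fun y hy => (hmem y hy).1, fun y hy => ?_⟩
  obtain ⟨_, hy1, hy2⟩ := hmem y hy
  rw [hA1] at hy1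
  rcases hy1 with hy1 | hy1
  · exact absurd hy1 hy2
  · exact hy1

lemma p1p2_of_inH {V : Type} [Finite V] (K : ℕ) (G : SimpleGraph V) (x : V) (h : InH K G)
    (hd : 1 ≤ minDeg G) : P1 K G ∧ P2 K G := by
  have hcard : Nat.card V ≠ 1 := by
    intro h1
    have h3 : deg G x = 0 := by
      have : Subsingleton V := (Nat.card_eq_one_iff_unique.1 h1).1
      unfold deg
      rw [Set.ncard_eq_zero (Set.toFinite _)]
      ext z
      simp only [SimpleGraph.mem_neighborSet, Set.mem_empty_iff_false, iff_false]
      intro ha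
      exact ha.ne (Subsingleton.elim _ _)
    have h4 : minDeg G ≤ deg G x := Nat.sInf_le ⟨x, rfl⟩
    omega
  obtain ⟨n, hn⟩ := h
  cases n with
  | zero => exact absurd hn hcard
  | succ n =>
    rcases hn with hn | hn
    · exact absurd hn hcard
    · exact ⟨hn.1, hn.2.1⟩
set_option maxHeartbeats 2000000 in
/-- Lemma: the `Boot₂(γ)` process rarely infects in round two. -/
theorem statement8 (K : ℕ) (c : ℝ) (hc : 1 / 2 < c) :
    ∃ D₀ : ℕ, ∀ (V : Type) [Finite V], ∀ G : SimpleGraph V,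
      InH K G → D₀ ≤ minDeg G → ∀ x : V,
      prob (1 / 2 - c * Real.sqrt (Real.log (deg G x) / (deg G x)))
          (fun A0 => x ∈ hatIter G A0 2 \ hatIter G A0 1)
        ≤ Real.exp (-Real.sqrt (deg G x)) := by
  classical
  obtain ⟨c₁, hc₁, hc₁c⟩ : ∃ c₁ : ℝ, 1 / 2 < c₁ ∧ c₁ < c := exists_between hc
  have hc₁p : 0 < c₁ := by linarith
  obtain ⟨η, hη, hηe⟩ : ∃ η : ℝ, 0 < η ∧ 2 * c₁ ^ 2 * (1 - η) = 1 / 2 + 2 * η := by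
    refine ⟨(2 * c₁ ^ 2 - 1 / 2) / (2 * c₁ ^ 2 + 2), div_pos (by nlinarith) (by positivity), ?_⟩
    field_simp
    ring
  obtain ⟨D₀, hD3, hD⟩ := analytic K c c₁ η hc₁c hη
  refine ⟨D₀, ?_⟩
  intro V _ G hG hmin x
  have := Fintype.ofFinite V
  obtain ⟨h1, h2⟩ := p1p2_of_inH K G x hG (by omega)
  have hdeg : ∀ y, D₀ ≤ deg G y := fun y => hmin.trans (Nat.sInf_le ⟨y, rfl⟩)
  obtain ⟨a1, a2, a3, a4, a5, a6, a7⟩ := hD _ (hdeg x)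
  set d : ℝ := (deg G x : ℝ) with hd
  have hd3 : (3 : ℝ) ≤ d := by
    have := hD3.trans (hdeg x)
    rw [hd]
    exact_mod_cast this
  set L : ℝ := Real.log d with hL
  set r : ℝ := √d with hr
  set l : ℝ := √L with hl
  set q : ℝ := √l with hq
  have hr2 : r ^ 2 = d := Real.sq_sqrt (by linarith)
  have hr1 : 1 ≤ r := Real.one_le_sqrt.2 (by linarith)
  have hL0 : 0 ≤ L := Real.log_nonneg (by linarith)
  have hl2 : l ^ 2 = L := Real.sq_sqrt hL0
  have hq2 : q ^ 2 = l := Real.sq_sqrt (by linarith)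
  have hq1 : 1 ≤ q := Real.one_le_sqrt.2 a4
  have hr0 : 0 < r := by linarith
  have hl0 : 0 < l := by linarith
  have hq0 : 0 < q := by linarith
  have hs : √(L / d) = l / r := Real.sqrt_div hL0 _
  have hγ : gamma' G x = r / q := by
    unfold gamma'
    rw [Real.sqrt_div (by positivity)]
  have hK0 : (0 : ℝ) ≤ K := by positivity
  rw [hs]
  have hcl : c * (l / r) ≤ 1 / 2 := by
    rw [← mul_div_assoc, div_le_iff₀ hr0]; linarith
  have hcl0 : 0 ≤ c * (l / r) := by
    have : 0 ≤ c := by linarith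
    positivity
  set t : ℕ := ⌈gamma' G x⌉₊ with ht
  have hγ0 : 0 < r / q := by positivity
  have htγ : r / q ≤ (t : ℝ) := by rw [← hγ]; exact Nat.le_ceil _
  have htr : (t : ℝ) ≤ r + 1 := by
    have h := (Nat.ceil_lt_add_one (a := gamma' G x) (by rw [hγ]; positivity)).le
    have : r / q ≤ r := div_le_self hr0.le hq1
    rw [← ht, hγ] at h
    linarith
  -- the exponential moment bound
  have main : prob (1 / 2 - c * (l / r)) (fun A0 => x ∈ hatIter G A0 2 \ hatIter G A0 1)
      ≤ (((Finset.univ.filter (fun y => G.Adj x y)).powersetCard t).card : ℝ)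
        * Real.exp (t * (-((1 / 2 + 2 * η) * L))) := by
    refine prob_le_union _ (by linarith) (by linarith) _ _ (mult G)
      (fun T => ∑ y ∈ T, ((deg G y : ℝ) / 2 - 2 * gamma' G y)) (4 * c₁ * (l / r)) _
      (by positivity) ?_ ?_
    · intro A hA
      obtain ⟨T, hTc, hTa, hTb⟩ := event_sub G x A hA
      refine ⟨T, ?_, ?_⟩
      · rw [Finset.mem_powersetCard]
        exact ⟨fun y hy => by simpa using hTa y hy, hTc⟩
      · rw [sum_mult]
        exact Finset.sum_le_sum hTb
    · intro T hT
      rw [Finset.mem_powersetCard] at hT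
      have hTa : ∀ y ∈ T, G.Adj x y := fun y hy => by simpa using hT.1 hy
      have hsq := sum_mult_sq K G h2 x T hTa
      rw [hT.2] at hsq
      rw [sum_mult_univ]
      have hsq' := mul_le_mul_of_nonneg_left hsq
        (show 0 ≤ (4 * c₁ * (l / r)) ^ 2 / 8 by positivity)
      refine (add_le_add le_rfl hsq').trans ?_
      rw [Finset.mul_sum, Finset.mul_sum, Finset.mul_sum, ← Finset.sum_add_distrib,
        ← Finset.sum_add_distrib, ← hT.2, ← nsmul_eq_mul]
      refine Finset.sum_le_card_nsmul _ _ _ (fun y hy => ?_)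
      rw [hT.2]
      have hxy : |(deg G x : ℤ) - (deg G y : ℤ)| ≤ (K : ℤ) * (1 : ℕ) :=
        h1 x 1 le_rfl y (by
          show G.edist x y = _
          rw [SimpleGraph.edist_eq_one_iff_adj.2 (hTa y hy)]; rfl)
      have hxy' : |d - (deg G y : ℝ)| ≤ K := by
        have : ((|(deg G x : ℤ) - (deg G y : ℤ)| : ℤ) : ℝ) ≤ (((K : ℤ) * (1 : ℕ) : ℤ) : ℝ) := by
          exact_mod_cast hxy
        simpa using this
      obtain ⟨b1, b2⟩ := abs_le.1 hxy'
      obtain ⟨_, _, _, a4y, _, _, _⟩ := hD _ (hdeg y)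
      have hγy : gamma' G y ≤ 3 / 2 * r := by
        unfold gamma'
        apply Real.sqrt_le_iff.2
        refine ⟨by positivity, (div_le_self (by positivity) a4y).trans ?_⟩
        nlinarith
      have hR : c₁ * (r * l) ≤ (deg G y : ℝ) * (c * (l / r)) - 2 * gamma' G y := by
        have e1 : (d - K) * (c * (l / r)) ≤ (deg G y : ℝ) * (c * (l / r)) :=
          mul_le_mul_of_nonneg_right (by linarith) hcl0
        have e2 : d * (c * (l / r)) = c * (r * l) := by
          rw [← hr2]; field_simp
        have e3 : K * (c * (l / r)) ≤ r * (1 / 2) :=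
          mul_le_mul a2 hcl hcl0 hr0.le
        have e4 := mul_le_mul_of_nonneg_left a3 hr0.le
        have e5 : r * ((c - c₁) * l) = c * (r * l) - c₁ * (r * l) := by ring
        have e6 : (d - K) * (c * (l / r)) = d * (c * (l / r)) - K * (c * (l / r)) := by ring
        linarith
      have hQ : (deg G y : ℝ) + 2 * K * t ≤ (1 + η) * d := by
        have e1 := mul_le_mul_of_nonneg_left htr (show 0 ≤ 2 * (K : ℝ) by positivity)
        linarith
      have f1 := mul_le_mul_of_nonneg_left hR (show 0 ≤ 4 * c₁ * (l / r) by positivity)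
      have f2 := mul_le_mul_of_nonneg_left hQ
        (show 0 ≤ (4 * c₁ * (l / r)) ^ 2 / 8 by positivity)
      have f3 : 4 * c₁ * (l / r) * (c₁ * (r * l)) = 4 * c₁ ^ 2 * L := by
        rw [← hl2]; field_simp
      have f4 : (4 * c₁ * (l / r)) ^ 2 / 8 * ((1 + η) * d) = 2 * c₁ ^ 2 * (1 + η) * L := by
        rw [← hl2, ← hr2]; field_simp; ring
      have f5 : 2 * c₁ ^ 2 * (1 - η) * L = (1 / 2 + 2 * η) * L := by rw [hηe]
      rw [f3] at f1
      rw [f4] at f2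
      linarith
  refine main.trans ?_
  have hN : (Finset.univ.filter (fun y => G.Adj x y)).card = deg G x := by
    unfold deg
    rw [← Set.ncard_coe_finset]
    congr 1
    ext z; simp
  rw [Finset.card_powersetCard, hN]
  have hch := choose_bound (deg G x) t (r / q) hγ0 htγ
  rw [← hd] at hch
  have hbase : Real.exp 1 * d / (r / q) ≤ Real.exp ((1 / 2 + η) * L) := by
    have e1 : Real.exp 1 * d / (r / q) = Real.exp 1 * (r * q) := by
      rw [← hr2]; field_simp
    have e2 : Real.exp (1 + (Real.log r + Real.log q)) = Real.exp 1 * (r * q) := by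
      rw [Real.exp_add, Real.exp_add, Real.exp_log hr0, Real.exp_log hq0]
    rw [e1, ← e2]
    apply Real.exp_le_exp.2
    have e3 : Real.log r = L / 2 := Real.log_sqrt (by linarith)
    have e4 : Real.log q = Real.log l / 2 := Real.log_sqrt hl0.le
    rw [e3, e4]
    linarith
  have hch2 : ((deg G x).choose t : ℝ) ≤ Real.exp (t * ((1 / 2 + η) * L)) := by
    refine hch.trans ?_
    rw [Real.exp_nat_mul]
    exact pow_le_pow_left₀ (by positivity) hbase t
  refine (mul_le_mul_of_nonneg_right hch2 (Real.exp_pos _).le).trans ?_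
  rw [← Real.exp_add]
  apply Real.exp_le_exp.2
  have g1 : r ≤ t * (η * L) := by
    have : r / q * (η * L) = r * (η * q ^ 3) := by
      rw [← hl2, ← hq2]; field_simp
    have g2 : r / q * (η * L) ≤ t * (η * L) :=
      mul_le_mul_of_nonneg_right htγ (by positivity)
    nlinarith
  linarith

end MBP
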